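/- Let |ψ⟩ be a stabilizer state on n ≥ 2 qubits and suppose there exist a qubit index i and a ∈ {x,y,z} such that Mᵢ ∈ {σ₀, σ_a} for every M ∈ 𝒮(ψ), with both values occurring. Then the reduced density matrix of |ψ⟩ obtained by tracing out qubit i is a pure state; in particular |ψ⟩ is a tensor product of a one-qubit state on qubit i and a stabilizer state on the remaining n−1 qubits, so |ψ⟩ is not fully entangled. -/

import Mathlib

open Matrix

noncomputable section

/-- Pauli matrices: `0 ↦ σ₀` (identity), `1 ↦ σₓ`, `2 ↦ σ_y`, `3 ↦ σ_z`. -/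
def pauliMat : Fin 4 → Matrix (Fin 2) (Fin 2) ℂ :=
  ![1, !![0, 1; 1, 0], !![0, -Complex.I; Complex.I, 0], !![1, 0; 0, -1]]

/-- Tensor (Kronecker) product of a family of one-qubit operators, as an operator
on qubits indexed by `ι`. -/
def kron {ι : Type} [Fintype ι] (U : ι → Matrix (Fin 2) (Fin 2) ℂ) :
    Matrix (ι → Fin 2) (ι → Fin 2) ℂ :=
  Matrix.of fun x y => ∏ i, U i (x i) (y i)

/-- An element of the Pauli group: a phase in `{1, -1, i, -i}` together with a
Pauli label (`σ₀, σₓ, σ_y, σ_z`) on every qubit. -/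
structure PauliOp (ι : Type) where
  phase : ℂ
  label : ι → Fin 4
  phase_ok : phase = 1 ∨ phase = -1 ∨ phase = Complex.I ∨ phase = -Complex.I

noncomputable instance {ι : Type} : DecidableEq (PauliOp ι) := Classical.decEq _

/-- The matrix of a Pauli group element. -/
def PauliOp.toMatrix {ι : Type} [Fintype ι] (M : PauliOp ι) :
    Matrix (ι → Fin 2) (ι → Fin 2) ℂ :=
  M.phase • kron fun i => pauliMat (M.label i)

/-- The support of a Pauli operator: the set of qubits on which it acts nontrivially. -/
def PauliOp.support {ι : Type} [Fintype ι] [DecidableEq ι] (M : PauliOp ι) : Finset ι :=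
  Finset.univ.filter fun i => M.label i ≠ 0

/-- A (maximal) stabilizer on the qubits indexed by `ι`: an abelian subgroup of the
Pauli group of cardinality `2^|ι|` which does not contain `-I`. -/
structure Stabilizer (ι : Type) [Fintype ι] [DecidableEq ι] where
  elems : Finset (PauliOp ι)
  one_mem : ∃ M ∈ elems, PauliOp.toMatrix M = 1
  mul_mem : ∀ M ∈ elems, ∀ N ∈ elems, ∃ K ∈ elems,
    PauliOp.toMatrix K = PauliOp.toMatrix M * PauliOp.toMatrix N
  comm : ∀ M ∈ elems, ∀ N ∈ elems,
    PauliOp.toMatrix M * PauliOp.toMatrix N = PauliOp.toMatrix N * PauliOp.toMatrix M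
  neg_one_not_mem : ∀ M ∈ elems, PauliOp.toMatrix M ≠ -1
  card_elems : elems.card = 2 ^ Fintype.card ι

variable {ι : Type} [Fintype ι] [DecidableEq ι]

/-- `ψ` is the stabilizer state of the stabilizer `S`: it is a unit vector fixed by
every element of `S`. -/
def stabilizesState (S : Stabilizer ι) (ψ : (ι → Fin 2) → ℂ) : Prop :=
  (∑ x, Complex.normSq (ψ x)) = 1 ∧ ∀ M ∈ S.elems, (PauliOp.toMatrix M).mulVec ψ = ψ

/-- `ψ` is a stabilizer state. -/
def IsStabilizerState (ψ : (ι → Fin 2) → ℂ) : Prop :=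
  ∃ S : Stabilizer ι, stabilizesState S ψ

/-- `A_ω(ψ)`: the number of stabilizer elements with support exactly `ω`. -/
def Aomega (S : Stabilizer ι) (ω : Finset ι) : ℕ :=
  (S.elems.filter fun M => PauliOp.support M = ω).card

/-- `ω` is a minimal support of `S`: it is the support of some element of `S`, and no
element of `S` has nonempty support strictly contained in `ω`. -/
def IsMinimalSupport (S : Stabilizer ι) (ω : Finset ι) : Prop :=
  (∃ M ∈ S.elems, PauliOp.support M = ω) ∧
    ∀ M ∈ S.elems, PauliOp.support M ⊂ ω → PauliOp.support M = ∅

/-- The matrices of the minimal elements of `S` (the elements whose support is a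
minimal support). -/
def minimalMatrices (S : Stabilizer ι) : Set (Matrix (ι → Fin 2) (ι → Fin 2) ℂ) :=
  {A | ∃ M ∈ S.elems, IsMinimalSupport S (PauliOp.support M) ∧ PauliOp.toMatrix M = A}

/-- `M` belongs to the subgroup `ℳ(ψ)` of `S` generated by the minimal elements.
(Every stabilizer element is an involution, so the generated submonoid coincides with
the generated subgroup.) -/
def inMinimalSubgroup (S : Stabilizer ι) (M : PauliOp ι) : Prop :=
  M ∈ S.elems ∧ PauliOp.toMatrix M ∈ Submonoid.closure (minimalMatrices S)

/-- A one-qubit Clifford operation: a unitary mapping each of the three Pauli matrices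
to a Pauli matrix, up to sign, under conjugation. -/
def IsClifford (U : Matrix (Fin 2) (Fin 2) ℂ) : Prop :=
  U ∈ Matrix.unitaryGroup (Fin 2) ℂ ∧
    ∃ π : Equiv.Perm (Fin 3), ∀ u : Fin 3, ∃ s : ℂ, (s = 1 ∨ s = -1) ∧
      U * pauliMat u.succ * Uᴴ = s • pauliMat (π u).succ

/-- Local unitary equivalence of pure states. -/
def LUequiv (ψ φ : (ι → Fin 2) → ℂ) : Prop :=
  ∃ U : ι → Matrix (Fin 2) (Fin 2) ℂ,
    (∀ i, U i ∈ Matrix.unitaryGroup (Fin 2) ℂ) ∧ (kron U).mulVec ψ = φ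

/-- Local Clifford equivalence of pure states. -/
def LCequiv (ψ φ : (ι → Fin 2) → ℂ) : Prop :=
  ∃ U : ι → Matrix (Fin 2) (Fin 2) ℂ,
    (∀ i, IsClifford (U i)) ∧ (kron U).mulVec ψ = φ

/-- Local Clifford equivalence of (possibly mixed) states. -/
def LCequivMixed (ρ ρ' : Matrix (ι → Fin 2) (ι → Fin 2) ℂ) : Prop :=
  ∃ U : ι → Matrix (Fin 2) (Fin 2) ℂ,
    (∀ i, IsClifford (U i)) ∧ kron U * ρ * (kron U)ᴴ = ρ'

/-- A pure state is fully entangled if it is not a tensor product of states on two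
complementary nonempty subsets of the qubits. -/
def FullyEntangled (ψ : (ι → Fin 2) → ℂ) : Prop :=
  ¬ ∃ (ω : Finset ι) (φ : ({i // i ∈ ω} → Fin 2) → ℂ) (χ : ({i // i ∉ ω} → Fin 2) → ℂ),
      ω ≠ ∅ ∧ ω ≠ Finset.univ ∧
        ∀ x : ι → Fin 2, ψ x = φ (fun i => x i.1) * χ (fun i => x i.1)

/-- Recombine an assignment on `ω` and one on its complement into a global assignment. -/
def mergeAssign (ω : Finset ι) (x : {i // i ∈ ω} → Fin 2) (z : {i // i ∉ ω} → Fin 2) :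
    ι → Fin 2 :=
  fun i => if h : i ∈ ω then x ⟨i, h⟩ else z ⟨i, h⟩

/-- The reduced density matrix `ρ_ω(ψ)` of the pure state `ψ` on the qubits in `ω`
(partial trace of `|ψ⟩⟨ψ|` over the qubits outside `ω`). -/
def reducedState (ψ : (ι → Fin 2) → ℂ) (ω : Finset ι) :
    Matrix ({i // i ∈ ω} → Fin 2) ({i // i ∈ ω} → Fin 2) ℂ :=
  Matrix.of fun x y =>
    ∑ z : {i // i ∉ ω} → Fin 2, ψ (mergeAssign ω x z) * (starRingEnd ℂ) (ψ (mergeAssign ω y z))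

/-- The restriction `α_M M_{i₁} ⊗ ⋯ ⊗ M_{i_k}` of a Pauli operator to the qubits in `ω`. -/
def PauliOp.restrict (M : PauliOp ι) (ω : Finset ι) :
    Matrix ({i // i ∈ ω} → Fin 2) ({i // i ∈ ω} → Fin 2) ℂ :=
  M.phase • kron fun i : {i // i ∈ ω} => pauliMat (M.label i.1)

/-- The `n`-qubit GHZ state `(|0…0⟩ + |1…1⟩)/√2`. -/
def ghz (n : ℕ) : (Fin n → Fin 2) → ℂ :=
  fun x => if x = (fun _ => 0) ∨ x = (fun _ => 1) then ((Real.sqrt 2 : ℝ)⁻¹ : ℂ) else 0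

/-- The `2n × 2n` binary symplectic form `P = [[0, I], [I, 0]]`. -/
def Pmat (n : ℕ) : Matrix (Fin n ⊕ Fin n) (Fin n ⊕ Fin n) (ZMod 2) :=
  Matrix.fromBlocks 0 1 1 0

end

noncomputable section

lemma kron_mul_kron {ι : Type} [Fintype ι] [DecidableEq ι]
    (U V : ι → Matrix (Fin 2) (Fin 2) ℂ) :
    kron U * kron V = kron fun i => U i * V i := by
  ext x y
  simp only [kron, Matrix.mul_apply, Matrix.of_apply, ← Finset.prod_mul_distrib]
  rw [Finset.prod_univ_sum, Fintype.piFinset_univ]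

lemma trace_kron {ι : Type} [Fintype ι] [DecidableEq ι] (U : ι → Matrix (Fin 2) (Fin 2) ℂ) :
    (kron U).trace = ∏ i, (U i).trace := by
  simp only [kron, Matrix.trace, Matrix.diag_apply, Matrix.of_apply]
  rw [Finset.prod_univ_sum, Fintype.piFinset_univ]

lemma kron_one {ι : Type} [Fintype ι] [DecidableEq ι] :
    kron (fun _ : ι => (1 : Matrix (Fin 2) (Fin 2) ℂ)) = 1 := by
  ext x y
  simp only [kron, Matrix.of_apply, Matrix.one_apply, funext_iff]
  by_cases h : ∀ i, x i = y i
  · simp [h]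
  · rw [if_neg h]
    push Not at h
    obtain ⟨i, hi⟩ := h
    exact Finset.prod_eq_zero (Finset.mem_univ i) (if_neg hi)

lemma pauliMat_mul_self (a : Fin 4) : pauliMat a * pauliMat a = 1 := by
  fin_cases a <;> ext i j <;> fin_cases i <;> fin_cases j <;>
    simp [pauliMat, Matrix.mul_apply, Fin.sum_univ_two]

lemma trace_pauliMat_mul_ne_zero_iff (a b : Fin 4) :
    (pauliMat a * pauliMat b).trace ≠ 0 ↔ a = b := by
  fin_cases a <;> fin_cases b <;>
    simp [pauliMat, Matrix.trace, Fin.sum_univ_two]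

lemma trace_pauliMat_ne_zero_iff (a : Fin 4) : (pauliMat a).trace ≠ 0 ↔ a = 0 := by
  simpa [pauliMat] using trace_pauliMat_mul_ne_zero_iff a 0

namespace PauliOp

lemma phase_ne_zero {ι : Type} (M : PauliOp ι) : M.phase ≠ 0 := by
  rcases M.phase_ok with h | h | h | h <;> simp [h]

lemma ext' {ι : Type} {M N : PauliOp ι} (hp : M.phase = N.phase) (hl : M.label = N.label) :
    M = N := by
  cases M; cases N; simp_all

/-- The identity element of the Pauli group. -/
def identity (ι : Type) : PauliOp ι := ⟨1, fun _ => 0, Or.inl rfl⟩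

/-- Restriction of a Pauli operator along a map of qubits. -/
def restrictOp {ι κ : Type} (M : PauliOp ι) (f : κ → ι) : PauliOp κ :=
  ⟨M.phase, fun j => M.label (f j), M.phase_ok⟩

variable {ι : Type} [Fintype ι] [DecidableEq ι]

lemma toMatrix_of_label_eq_zero {M : PauliOp ι} (h : ∀ i, M.label i = 0) :
    M.toMatrix = M.phase • 1 := by
  have : (fun i => pauliMat (M.label i)) = fun _ => 1 := by
    funext i; rw [h i]; rfl
  rw [toMatrix, this, kron_one]

lemma toMatrix_identity : (identity ι).toMatrix = 1 := by
  rw [toMatrix_of_label_eq_zero fun _ => rfl]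
  simp [identity]

lemma toMatrix_mul_self (M : PauliOp ι) : M.toMatrix * M.toMatrix = (M.phase ^ 2) • 1 := by
  simp only [toMatrix, smul_mul_smul_comm, kron_mul_kron, pauliMat_mul_self, kron_one, sq]

lemma toMatrix_mul_left_cancel (M : PauliOp ι) {A B : Matrix (ι → Fin 2) (ι → Fin 2) ℂ}
    (h : M.toMatrix * A = M.toMatrix * B) : A = B := by
  have := congrArg (M.toMatrix * ·) h
  simp only [← mul_assoc, toMatrix_mul_self, smul_mul_assoc, one_mul] at this
  exact smul_right_injective _ (pow_ne_zero 2 M.phase_ne_zero) this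

lemma trace_label_mul_ne_zero {M : PauliOp ι} {c : ℂ} {U : ι → Matrix (Fin 2) (Fin 2) ℂ}
    (h : M.toMatrix = c • kron U) (i : ι) : (pauliMat (M.label i) * U i).trace ≠ 0 := by
  intro h0
  have h1 : (M.toMatrix * M.toMatrix).trace = 0 := by
    nth_rewrite 2 [h]
    rw [toMatrix, smul_mul_smul_comm, kron_mul_kron, Matrix.trace_smul, trace_kron,
      Finset.prod_eq_zero (Finset.mem_univ i) h0, smul_zero]
  rw [toMatrix_mul_self, Matrix.trace_smul, Matrix.trace_one] at h1
  simp [M.phase_ne_zero] at h1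

lemma toMatrix_injective : Function.Injective (toMatrix : PauliOp ι → _) := by
  intro M N h
  have hl : M.label = N.label := funext fun i =>
    (trace_pauliMat_mul_ne_zero_iff _ _).1 (trace_label_mul_ne_zero h i)
  refine ext' ?_ hl
  have hM : M.toMatrix ≠ 0 := fun h0 => by
    have := toMatrix_mul_self M
    rw [h0, zero_mul] at this
    exact smul_ne_zero (pow_ne_zero 2 M.phase_ne_zero) one_ne_zero this.symm
  rw [toMatrix] at hM
  refine smul_left_injective ℂ (right_ne_zero_of_smul hM) ?_
  simpa only [toMatrix, hl] using h

lemma trace_label_mul_mul_ne_zero {K M N : PauliOp ι}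
    (h : K.toMatrix = M.toMatrix * N.toMatrix) (i : ι) :
    (pauliMat (K.label i) * (pauliMat (M.label i) * pauliMat (N.label i))).trace ≠ 0 := by
  refine trace_label_mul_ne_zero (c := M.phase * N.phase)
    (U := fun i => pauliMat (M.label i) * pauliMat (N.label i)) ?_ i
  rw [h, toMatrix, toMatrix, smul_mul_smul_comm, kron_mul_kron]

lemma label_eq_of_toMatrix_eq_mul_right {K M N : PauliOp ι}
    (h : K.toMatrix = M.toMatrix * N.toMatrix) {i : ι} (hN : N.label i = 0) :
    K.label i = M.label i := by
  have := trace_label_mul_mul_ne_zero h i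
  rw [hN, show pauliMat 0 = 1 from rfl, mul_one] at this
  exact (trace_pauliMat_mul_ne_zero_iff _ _).1 this

lemma label_eq_zero_of_toMatrix_eq_mul {K M N : PauliOp ι}
    (h : K.toMatrix = M.toMatrix * N.toMatrix) {i : ι} (hMN : M.label i = N.label i) :
    K.label i = 0 := by
  have := trace_label_mul_mul_ne_zero h i
  rw [hMN, pauliMat_mul_self, mul_one] at this
  exact (trace_pauliMat_ne_zero_iff _).1 this

end PauliOp

namespace Stabilizer

variable {ι : Type} [Fintype ι] [DecidableEq ι] (S : Stabilizer ι)

lemma identity_mem : PauliOp.identity ι ∈ S.elems := by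
  obtain ⟨M, hM, h⟩ := S.one_mem
  rwa [← PauliOp.toMatrix_injective (h.trans PauliOp.toMatrix_identity.symm)]

lemma eq_identity_of_label_eq_zero {M : PauliOp ι} (hM : M ∈ S.elems)
    (h : ∀ i, M.label i = 0) : M = PauliOp.identity ι := by
  have hm := PauliOp.toMatrix_of_label_eq_zero h
  have hsq : M.phase ^ 2 ≠ -1 := fun hp => by
    obtain ⟨K, hK, hKM⟩ := S.mul_mem M hM M hM
    refine S.neg_one_not_mem K hK ?_
    rw [hKM, PauliOp.toMatrix_mul_self, hp, neg_one_smul]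
  refine PauliOp.ext' ?_ (funext h)
  rcases M.phase_ok with hp | hp | hp | hp
  · exact hp
  · exact absurd (by rw [hm, hp, neg_one_smul]) (S.neg_one_not_mem M hM)
  · exact absurd (by simp [hp]) hsq
  · exact absurd (by simp [hp]) hsq

lemma trace_eq_zero {M : PauliOp ι} (hM : M ∈ S.elems) (h : M ≠ PauliOp.identity ι) :
    M.toMatrix.trace = 0 := by
  obtain ⟨i, hi⟩ : ∃ i, M.label i ≠ 0 := by
    by_contra! hl
    exact h (S.eq_identity_of_label_eq_zero hM hl)
  have h0 : (pauliMat (M.label i)).trace = 0 :=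
    not_not.1 (mt (trace_pauliMat_ne_zero_iff _).1 hi)
  rw [PauliOp.toMatrix, Matrix.trace_smul, trace_kron,
    Finset.prod_eq_zero (Finset.mem_univ i) h0, smul_zero]

lemma trace_sum : (∑ M ∈ S.elems, M.toMatrix).trace = 2 ^ Fintype.card ι := by
  rw [Matrix.trace_sum, Finset.sum_eq_single_of_mem _ S.identity_mem
    fun M hM h => S.trace_eq_zero hM h, PauliOp.toMatrix_identity, Matrix.trace_one]
  simp

/-- The product of two elements of a stabilizer. -/
def mul (M N : S.elems) : S.elems :=
  ⟨(S.mul_mem M M.2 N N.2).choose, (S.mul_mem M M.2 N N.2).choose_spec.1⟩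

lemma toMatrix_mul (M N : S.elems) :
    (S.mul M N).1.toMatrix = M.1.toMatrix * N.1.toMatrix :=
  (S.mul_mem M M.2 N N.2).choose_spec.2

lemma mul_injective (M : S.elems) : Function.Injective (S.mul M) := fun N N' h =>
  Subtype.ext <| PauliOp.toMatrix_injective <| M.1.toMatrix_mul_left_cancel <| by
    rw [← toMatrix_mul, ← toMatrix_mul, h]

lemma mul_sum {M : PauliOp ι} (hM : M ∈ S.elems) :
    M.toMatrix * ∑ N ∈ S.elems, N.toMatrix = ∑ N ∈ S.elems, N.toMatrix := by
  rw [Finset.mul_sum, ← Finset.sum_coe_sort S.elems fun N => M.toMatrix * N.toMatrix,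
    ← Finset.sum_coe_sort S.elems fun N => N.toMatrix]
  refine Fintype.sum_bijective (S.mul ⟨M, hM⟩)
    (Finite.injective_iff_bijective.1 (S.mul_injective _)) _ _ fun N => ?_
  rw [S.toMatrix_mul]

/-- The projection onto the vectors fixed by a stabilizer. -/
def proj : Matrix (ι → Fin 2) (ι → Fin 2) ℂ :=
  ((2 : ℂ) ^ Fintype.card ι)⁻¹ • ∑ M ∈ S.elems, M.toMatrix

lemma proj_mul_proj : S.proj * S.proj = S.proj := by
  have h : (∑ M ∈ S.elems, M.toMatrix) * (∑ M ∈ S.elems, M.toMatrix) =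
      (2 : ℂ) ^ Fintype.card ι • ∑ M ∈ S.elems, M.toMatrix := by
    rw [Finset.sum_mul, Finset.sum_congr rfl fun M hM => S.mul_sum hM, Finset.sum_const,
      S.card_elems, ← Nat.cast_smul_eq_nsmul ℂ]
    simp
  rw [proj, smul_mul_smul_comm, h, smul_smul, mul_assoc, inv_mul_cancel₀ (by simp), mul_one]

lemma finrank_range_proj : Module.finrank ℂ (LinearMap.range (Matrix.toLin' S.proj)) = 1 := by
  have hid : IsIdempotentElem (Matrix.toLin' S.proj) := by
    rw [IsIdempotentElem, Module.End.mul_eq_comp, ← Matrix.toLin'_mul, S.proj_mul_proj]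
  have h := ((LinearMap.isProj_range_iff_isIdempotentElem _).2 hid).trace
  rw [Matrix.trace_toLin'_eq, proj, Matrix.trace_smul, S.trace_sum, smul_eq_mul,
    inv_mul_cancel₀ (by simp)] at h
  exact_mod_cast h.symm

lemma proj_mulVec {w : (ι → Fin 2) → ℂ} (hw : ∀ M ∈ S.elems, M.toMatrix.mulVec w = w) :
    S.proj.mulVec w = w := by
  rw [proj, Matrix.smul_mulVec, Matrix.sum_mulVec, Finset.sum_congr rfl fun M hM => hw M hM, Finset.sum_const,
    S.card_elems, ← Nat.cast_smul_eq_nsmul ℂ, smul_smul]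
  simp

/-- The vectors fixed by a stabilizer form a line. -/
lemma exists_smul_eq_of_fixed {v w : (ι → Fin 2) → ℂ} (hv0 : v ≠ 0)
    (hv : ∀ M ∈ S.elems, M.toMatrix.mulVec v = v) (hw : ∀ M ∈ S.elems, M.toMatrix.mulVec w = w) :
    ∃ c : ℂ, c • v = w := by
  have mem : ∀ u : (ι → Fin 2) → ℂ, (∀ M ∈ S.elems, M.toMatrix.mulVec u = u) →
      u ∈ LinearMap.range (Matrix.toLin' S.proj) := fun u hu =>
    ⟨u, by rw [Matrix.toLin'_apply, S.proj_mulVec hu]⟩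
  obtain ⟨c, hc⟩ := (finrank_eq_one_iff_of_nonzero'
    (⟨v, mem v hv⟩ : LinearMap.range (Matrix.toLin' S.proj))
    (fun h => hv0 (congrArg Subtype.val h))).1 S.finrank_range_proj ⟨w, mem w hw⟩
  exact ⟨c, congrArg Subtype.val hc⟩

end Stabilizer

section SplitQubit

variable {ι κ : Type} (e : Option κ ≃ ι)

/-- Split an assignment on `Option κ ≃ ι` into its restriction to `κ` and its value
on the remaining qubit. -/
def splitQubit : (ι → Fin 2) ≃ (κ → Fin 2) × Fin 2 where
  toFun x := (fun j => x (e (some j)), x (e none))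
  invFun p j := (e.symm j).elim p.2 p.1
  left_inv x := by
    funext j
    obtain ⟨k, rfl⟩ := e.surjective j
    cases k <;> simp
  right_inv p := by simp

/-- The operator on all qubits acting as `B` on `κ` and trivially on the remaining qubit. -/
def extendQubit (B : Matrix (κ → Fin 2) (κ → Fin 2) ℂ) : Matrix (ι → Fin 2) (ι → Fin 2) ℂ :=
  (Matrix.blockDiagonal fun _ : Fin 2 => B).submatrix (splitQubit e) (splitQubit e)

lemma extendQubit_neg (A : Matrix (κ → Fin 2) (κ → Fin 2) ℂ) :
    extendQubit e (-A) = -extendQubit e A := by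
  ext x y
  simp only [extendQubit, Matrix.submatrix_apply, Matrix.blockDiagonal_apply, Matrix.neg_apply]
  split_ifs <;> simp

lemma extendQubit_injective : Function.Injective (extendQubit e) := by
  intro A B h
  ext x y
  have := congrFun (congrFun h ((splitQubit e).symm (x, 0))) ((splitQubit e).symm (y, 0))
  simpa [extendQubit, Matrix.blockDiagonal_apply] using this

variable [Fintype ι] [Fintype κ]

lemma PauliOp.toMatrix_eq_extendQubit {M : PauliOp ι} (h : M.label (e none) = 0) :
    M.toMatrix = extendQubit e (M.restrictOp fun j => e (some j)).toMatrix := by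
  ext x y
  simp only [PauliOp.toMatrix, extendQubit, kron, PauliOp.restrictOp, Matrix.smul_apply,
    Matrix.of_apply, Matrix.submatrix_apply, Matrix.blockDiagonal_apply, splitQubit,
    Equiv.coe_fn_mk]
  rw [← e.prod_comp, Fintype.prod_option, h, show pauliMat 0 = 1 from rfl, Matrix.one_apply]
  split_ifs <;> simp

lemma extendQubit_one : extendQubit e 1 = 1 :=
  (congrArg (fun A => Matrix.submatrix A (splitQubit e) (splitQubit e))
    Matrix.blockDiagonal_one).trans (Matrix.submatrix_one_equiv _)

variable [DecidableEq ι] [DecidableEq κ]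

lemma extendQubit_mul (A B : Matrix (κ → Fin 2) (κ → Fin 2) ℂ) :
    extendQubit e (A * B) = extendQubit e A * extendQubit e B := by
  simp only [extendQubit, Matrix.submatrix_mul_equiv, Matrix.blockDiagonal_mul]

lemma extendQubit_mulVec (B : Matrix (κ → Fin 2) (κ → Fin 2) ℂ) (ψ : (ι → Fin 2) → ℂ)
    (y : κ → Fin 2) (b : Fin 2) :
    (extendQubit e B).mulVec ψ ((splitQubit e).symm (y, b)) =
      B.mulVec (fun y => ψ ((splitQubit e).symm (y, b))) y := by
  simp only [Matrix.mulVec, dotProduct]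
  rw [← (splitQubit e).symm.sum_comp, Fintype.sum_prod_type]
  simp [extendQubit, Matrix.blockDiagonal_apply]

end SplitQubit

namespace Stabilizer

variable {ι : Type} [Fintype ι] [DecidableEq ι] (S : Stabilizer ι)

lemma two_mul_card_filter_label_eq_zero {i : ι} {a : Fin 4} (ha : a ≠ 0)
    (hall : ∀ M ∈ S.elems, M.label i = 0 ∨ M.label i = a) (hA : ∃ M ∈ S.elems, M.label i = a) :
    2 * (S.elems.filter fun M => M.label i = 0).card = 2 ^ Fintype.card ι := by
  obtain ⟨N, hN, hNa⟩ := hA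
  have key : ∀ p q : Fin 4, (∀ M ∈ S.elems, M.label i = p → ∀ K : PauliOp ι,
      K.toMatrix = N.toMatrix * M.toMatrix → K.label i = q) →
      (S.elems.filter fun M => M.label i = p).card ≤
        (S.elems.filter fun M => M.label i = q).card := by
    intro p q hpq
    choose! f hf hfm using S.mul_mem N hN
    refine Finset.card_le_card_of_injOn f ?_ ?_
    · intro M hM
      simp only [Finset.coe_filter, Set.mem_ofPred_eq] at hM ⊢
      exact ⟨hf M hM.1, hpq M hM.1 hM.2 _ (hfm M hM.1)⟩
    · intro M hM M' hM' h
      simp only [Finset.coe_filter, Set.mem_ofPred_eq] at hM hM'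
      refine PauliOp.toMatrix_injective (N.toMatrix_mul_left_cancel ?_)
      rw [← hfm M hM.1, ← hfm M' hM'.1, h]
  have h1 := key 0 a fun M _ hM0 K hK =>
    (PauliOp.label_eq_of_toMatrix_eq_mul_right hK hM0).trans hNa
  have h2 := key a 0 fun M _ hMa K hK =>
    PauliOp.label_eq_zero_of_toMatrix_eq_mul hK (hNa.trans hMa.symm)
  have h3 : (S.elems.filter fun M => ¬ M.label i = 0) = S.elems.filter fun M => M.label i = a :=
    Finset.filter_congr fun M hM =>
      ⟨fun h => (hall M hM).resolve_left h, fun h h0 => ha (h.symm.trans h0)⟩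
  have h4 := Finset.card_filter_add_card_filter_not (s := S.elems) fun M => M.label i = 0
  rw [h3, S.card_elems] at h4
  omega

/-- The stabilizer on the qubits in `κ` consisting of the elements of `S` acting trivially
on the remaining qubit, when these form a subgroup of index two. -/
def eraseQubit {κ : Type} [Fintype κ] [DecidableEq κ] (e : Option κ ≃ ι)
    (hcard : 2 * (S.elems.filter fun M => M.label (e none) = 0).card = 2 ^ Fintype.card ι) :
    Stabilizer κ where
  elems := (S.elems.filter fun M => M.label (e none) = 0).image
    fun M => M.restrictOp fun j => e (some j)
  one_mem := by
    refine ⟨_, Finset.mem_image_of_mem _ (Finset.mem_filter.2 ⟨S.identity_mem, rfl⟩), ?_⟩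
    exact PauliOp.toMatrix_identity
  mul_mem := by
    simp only [Finset.forall_mem_image, Finset.exists_mem_image, Finset.mem_filter]
    rintro M ⟨hM, hM0⟩ N ⟨hN, hN0⟩
    obtain ⟨K, hK, hKM⟩ := S.mul_mem M hM N hN
    have hK0 := PauliOp.label_eq_zero_of_toMatrix_eq_mul hKM (hM0.trans hN0.symm)
    refine ⟨K, ⟨hK, hK0⟩, extendQubit_injective e ?_⟩
    rw [extendQubit_mul, ← PauliOp.toMatrix_eq_extendQubit e hK0, ← PauliOp.toMatrix_eq_extendQubit e hM0,
      ← PauliOp.toMatrix_eq_extendQubit e hN0, hKM]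
  comm := by
    simp only [Finset.forall_mem_image, Finset.mem_filter]
    rintro M ⟨hM, hM0⟩ N ⟨hN, hN0⟩
    refine extendQubit_injective e ?_
    rw [extendQubit_mul, extendQubit_mul, ← PauliOp.toMatrix_eq_extendQubit e hM0,
      ← PauliOp.toMatrix_eq_extendQubit e hN0, S.comm M hM N hN]
  neg_one_not_mem := by
    simp only [Finset.forall_mem_image, Finset.mem_filter]
    rintro M ⟨hM, hM0⟩ h
    refine S.neg_one_not_mem M hM ?_
    rw [PauliOp.toMatrix_eq_extendQubit e hM0, h, extendQubit_neg, extendQubit_one]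
  card_elems := by
    rw [Finset.card_image_of_injOn]
    · have h : Fintype.card ι = Fintype.card κ + 1 := by
        rw [← Fintype.card_congr e, Fintype.card_option]
      rw [h, pow_succ] at hcard
      omega
    · intro M hM N hN h
      simp only [Finset.coe_filter, Set.mem_ofPred_eq] at hM hN
      dsimp only at h
      refine PauliOp.ext' (congrArg PauliOp.phase h :) (funext fun j => ?_)
      obtain ⟨k, rfl⟩ := e.surjective j
      cases k with
      | none => rw [hM.2, hN.2]
      | some k => exact (congrFun (congrArg PauliOp.label h) k :)

end Stabilizer

lemma sum_normSq_of_product {ι κ : Type} [Fintype ι] [DecidableEq ι] [Fintype κ] [DecidableEq κ]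
    (e : Option κ ≃ ι) {ψ : (ι → Fin 2) → ℂ} {χ : Fin 2 → ℂ} {φ : (κ → Fin 2) → ℂ}
    (h : ∀ x, ψ x = χ (x (e none)) * φ fun j => x (e (some j))) :
    ∑ x, Complex.normSq (ψ x) =
      (∑ b, Complex.normSq (χ b)) * ∑ y, Complex.normSq (φ y) := by
  rw [Finset.sum_mul_sum, Finset.sum_comm, ← Fintype.sum_prod_type', ← (splitQubit e).sum_comp]
  simp only [h, Complex.normSq_mul]
  rfl

/-- If `ψ` is a product of `χ` on qubit `i` and a unit vector `φ` elsewhere, the reduced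
state on the other qubits is the projection onto `φ`. -/
lemma reducedState_erase_of_product {ι : Type} [Fintype ι] [DecidableEq ι] {i : ι}
    {ψ : (ι → Fin 2) → ℂ} {χ : Fin 2 → ℂ} {φ : ({j // j ∈ Finset.univ.erase i} → Fin 2) → ℂ}
    (h : ∀ x, ψ x = χ (x i) * φ fun j => x j.1) (hχ : ∑ b, Complex.normSq (χ b) = 1) :
    reducedState ψ (Finset.univ.erase i) =
      Matrix.of fun x y => φ x * (starRingEnd ℂ) (φ y) := by
  have hi : i ∉ Finset.univ.erase i := by simp
  have hm : ∀ x z, ψ (mergeAssign (Finset.univ.erase i) x z) = χ (z ⟨i, hi⟩) * φ x := by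
    intro x z
    rw [h]
    congr 2
    · simp [mergeAssign]
    · funext j
      simp only [mergeAssign, dif_pos j.2]
  let e : ({j // j ∉ Finset.univ.erase i} → Fin 2) ≃ Fin 2 :=
    { toFun := fun z => z ⟨i, hi⟩
      invFun := fun b _ => b
      left_inv := fun z => funext fun ⟨j, hj⟩ => by
        have : j = i := by simpa using hj
        subst this
        rfl
      right_inv := fun _ => rfl }
  ext x y
  simp only [reducedState, Matrix.of_apply, hm]
  refine (e.sum_comp fun b => χ b * φ x * (starRingEnd ℂ) (χ b * φ y)).trans ?_
  have hχ' : ∑ b, χ b * (starRingEnd ℂ) (χ b) = 1 := by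
    simp only [Complex.mul_conj]
    exact_mod_cast hχ
  calc ∑ b, χ b * φ x * (starRingEnd ℂ) (χ b * φ y)
      = (∑ b, χ b * (starRingEnd ℂ) (χ b)) * (φ x * (starRingEnd ℂ) (φ y)) := by
        rw [Finset.sum_mul]
        refine Finset.sum_congr rfl fun b _ => ?_
        rw [map_mul]; ring
    _ = φ x * (starRingEnd ℂ) (φ y) := by rw [hχ', one_mul]

lemma exists_smul_sum_normSq_eq_one {α : Type} [Fintype α] {v : α → ℂ} (hv : v ≠ 0) :
    ∃ c : ℂ, c ≠ 0 ∧ ∑ x, Complex.normSq ((c • v) x) = 1 := by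
  obtain ⟨x₀, hx₀⟩ := Function.ne_iff.1 hv
  have hpos : 0 < ∑ x, Complex.normSq (v x) :=
    Finset.sum_pos' (fun x _ => Complex.normSq_nonneg _)
      ⟨x₀, Finset.mem_univ _, Complex.normSq_pos.2 hx₀⟩
  refine ⟨((√(∑ x, Complex.normSq (v x)))⁻¹ : ℝ), ?_, ?_⟩
  · exact_mod_cast (inv_pos.2 (Real.sqrt_pos.2 hpos)).ne'
  · simp only [Pi.smul_apply, smul_eq_mul, Complex.normSq_mul, ← Finset.mul_sum,
      Complex.normSq_ofReal]
    rw [← mul_inv, Real.mul_self_sqrt hpos.le, inv_mul_cancel₀ hpos.ne']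

/-- A distinguished element together with the rest. -/
def optionErase {ι : Type} [Fintype ι] [DecidableEq ι] (i : ι) :
    Option {j // j ∈ Finset.univ.erase i} ≃ ι where
  toFun k := k.elim i Subtype.val
  invFun j := if h : j = i then none else some ⟨j, by simp [h]⟩
  left_inv k := by
    cases k with
    | none => simp
    | some k => simp [Finset.ne_of_mem_erase k.2]
  right_inv j := by
    by_cases h : j = i <;> simp [h]

/-- A vector fixed by a stabilizer whose elements acting trivially on one qubit have index two
is a product of a one-qubit vector and a stabilizer state. -/
lemma Stabilizer.exists_product_of_fixed {ι κ : Type} [Fintype ι] [DecidableEq ι] [Fintype κ]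
    [DecidableEq κ] (S : Stabilizer ι) {ψ : (ι → Fin 2) → ℂ} (hψ : stabilizesState S ψ)
    (e : Option κ ≃ ι)
    (hcard : 2 * (S.elems.filter fun M => M.label (e none) = 0).card = 2 ^ Fintype.card ι) :
    ∃ (χ : Fin 2 → ℂ) (φ : (κ → Fin 2) → ℂ), stabilizesState (S.eraseQubit e hcard) φ ∧
      ∀ x, ψ x = χ (x (e none)) * φ fun j => x (e (some j)) := by
  set T := S.eraseQubit e hcard
  let slice : Fin 2 → (κ → Fin 2) → ℂ :=
    fun b y => ψ ((splitQubit e).symm (y, b))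
  have hslice : ∀ x, ψ x = slice (x (e none)) fun j => x (e (some j)) := fun x =>
    congrArg ψ ((splitQubit e).symm_apply_apply x).symm
  have hfix : ∀ b, ∀ M ∈ T.elems, M.toMatrix.mulVec (slice b) = slice b := by
    intro b M hM
    obtain ⟨N, hN, rfl⟩ := Finset.mem_image.1 hM
    obtain ⟨hN, hN0⟩ := Finset.mem_filter.1 hN
    funext y
    rw [← extendQubit_mulVec, ← PauliOp.toMatrix_eq_extendQubit e hN0, hψ.2 N hN]
  obtain ⟨b, hb⟩ : ∃ b, slice b ≠ 0 := by
    by_contra! h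
    have h0 : ∀ x, ψ x = 0 := fun x => by rw [hslice, h]; rfl
    simpa [h0] using hψ.1
  obtain ⟨c, hc, hnorm⟩ := exists_smul_sum_normSq_eq_one hb
  have hφ : ∀ M ∈ T.elems, M.toMatrix.mulVec (c • slice b) = c • slice b := fun M hM => by
    rw [Matrix.mulVec_smul, hfix b M hM]
  choose χ hχ using fun b' => T.exists_smul_eq_of_fixed (smul_ne_zero hc hb) hφ (hfix b')
  refine ⟨χ, c • slice b, ⟨hnorm, hφ⟩, fun x => ?_⟩
  rw [hslice, ← hχ (x (e none))]
  rfl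

end

/-- If on some qubit `i` only `σ₀` and a single Pauli `σ_a` occur in
`𝒮(ψ)` (both occurring), then the reduced state on the remaining qubits is pure; in
particular `ψ` is a tensor product of a one-qubit state on qubit `i` and a stabilizer
state on the remaining `n - 1` qubits, so `ψ` is not fully entangled. -/
theorem stmt_17 {n : ℕ} (hn : 2 ≤ n) (S : Stabilizer (Fin n)) (ψ : (Fin n → Fin 2) → ℂ)
    (hψ : stabilizesState S ψ) (i : Fin n) (a : Fin 4) (ha : a ≠ 0)
    (hall : ∀ M ∈ S.elems, M.label i = 0 ∨ M.label i = a)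
    (h0 : ∃ M ∈ S.elems, M.label i = 0) (hA : ∃ M ∈ S.elems, M.label i = a) :
    (∃ φ : ({j // j ∈ Finset.univ.erase i} → Fin 2) → ℂ,
        (∑ x, Complex.normSq (φ x)) = 1 ∧
        reducedState ψ (Finset.univ.erase i)
          = Matrix.of (fun x y => φ x * (starRingEnd ℂ) (φ y))) ∧
    (∃ (χ : Fin 2 → ℂ) (φ : ({j // j ∈ Finset.univ.erase i} → Fin 2) → ℂ),
        IsStabilizerState φ ∧ ∀ x : Fin n → Fin 2, ψ x = χ (x i) * φ (fun j => x j.1)) ∧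
    ¬ FullyEntangled ψ := by
  let : Fintype {j // j ∈ Finset.univ.erase i} := Subtype.fintype _
  obtain ⟨χ, φ, hφ, hprod⟩ := S.exists_product_of_fixed hψ (optionErase i)
    (S.two_mul_card_filter_label_eq_zero ha hall hA)
  have hχ : ∑ b, Complex.normSq (χ b) = 1 := by
    have h := sum_normSq_of_product (optionErase i) hprod
    rwa [hφ.1, mul_one, hψ.1, eq_comm] at h
  refine ⟨⟨φ, hφ.1, reducedState_erase_of_product hprod hχ⟩, ⟨χ, φ, ⟨_, hφ⟩, hprod⟩, fun h => h ?_⟩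
  refine ⟨Finset.univ.erase i, φ, fun z => χ (z ⟨i, by simp⟩), fun h => ?_, fun h => ?_,
    fun x => (hprod x).trans (mul_comm _ _)⟩
  · have hc := Finset.card_erase_add_one (Finset.mem_univ i)
    rw [h, Finset.card_empty, Finset.card_univ, Fintype.card_fin] at hc
    omega
  · have hi := Finset.notMem_erase i Finset.univ
    rw [h] at hi
    exact hi (Finset.mem_univ i)
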